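/- arXiv:1701.04564 — 2 statements merged into one kernel-verified Lean document; each statement's English description precedes it below -/
import Mathlib

section
/- Let l > 0 and let u : [0,1] → ℝ be continuously differentiable with u' absolutely continuous and u'' square-integrable, and suppose u'(0) = 0. Then the total one-dimensional free energy Π_1D[u] = ∫₀¹ ( u'(X)^4 - 2 u'(X)^2 + l^2 u''(X)^2 ) dX is strictly greater than -1. In particular, no function satisfying the higher-order Dirichlet boundary condition u_{,X} = 0 at X = 0 attains the pointwise lower bound -1 of the energy when l > 0. -/
open MeasureTheory Set

/-- Let `l > 0` and let `u : [0,1] → ℝ` be continuously differentiable with `u'`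
absolutely continuous and `u''` square-integrable, and suppose `u'(0) = 0`.  Then the
total one-dimensional free energy
`Π_1D[u] = ∫₀¹ (u'(X)^4 - 2 u'(X)^2 + l^2 u''(X)^2) dX` is strictly greater than `-1`.
In particular, no function satisfying the higher-order Dirichlet boundary condition
`u_{,X} = 0` at `X = 0` attains the pointwise lower bound `-1` of the energy when `l > 0`. -/
theorem total_energy_1D_strict_lower_bound (l : ℝ) (hl : 0 < l) (u u' u'' : ℝ → ℝ)
    (hderiv : ∀ x ∈ Icc (0 : ℝ) 1, HasDerivAt u (u' x) x)
    (hu'cont : ContinuousOn u' (Icc (0 : ℝ) 1))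
    (hderiv2 : ∀ᵐ x ∂(volume.restrict (Icc (0 : ℝ) 1)), HasDerivAt u' (u'' x) x)
    (hsq : IntervalIntegrable (fun x => (u'' x) ^ 2) volume 0 1)
    (hbc : u' 0 = 0) :
    (∫ x in (0 : ℝ)..1, (u' x ^ 4 - 2 * u' x ^ 2 + l ^ 2 * u'' x ^ 2)) > -1 := by
  have hc : ContinuousOn (fun x => (u' x ^ 2 - 1) ^ 2) (Icc (0 : ℝ) 1) := by fun_prop
  have hc' : ContinuousOn (fun x => u' x ^ 4 - 2 * u' x ^ 2) (Icc (0 : ℝ) 1) := by fun_prop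
  have hwell : 0 < ∫ x in (0 : ℝ)..1, (u' x ^ 2 - 1) ^ 2 :=
    intervalIntegral.integral_pos zero_lt_one hc (fun x _ => sq_nonneg _)
      ⟨0, by simp, by simp [hbc]⟩
  have hint : IntervalIntegrable (fun x => u' x ^ 4 - 2 * u' x ^ 2 + l ^ 2 * u'' x ^ 2)
      volume 0 1 :=
    (hc'.intervalIntegrable_of_Icc zero_le_one).add (hsq.const_mul (l ^ 2))
  have hle : (∫ x in (0 : ℝ)..1, ((u' x ^ 2 - 1) ^ 2 - 1)) ≤
      ∫ x in (0 : ℝ)..1, (u' x ^ 4 - 2 * u' x ^ 2 + l ^ 2 * u'' x ^ 2) := by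
    refine intervalIntegral.integral_mono_on zero_le_one
      ((hc.intervalIntegrable_of_Icc zero_le_one).sub intervalIntegrable_const) hint
      fun x _ => ?_
    nlinarith [sq_nonneg (l * u'' x)]
  rw [intervalIntegral.integral_sub (hc.intervalIntegrable_of_Icc zero_le_one)
    intervalIntegrable_const, intervalIntegral.integral_const] at hle
  norm_num at hle
  linarith
end

section
/- Fix r > 0, B1 ≥ 0, B5 ≥ 0, l ≥ 0, and set B2 = -3/(2 r²), B3 = 1/r³, B4 = 3/(2 r⁴). Then for all real numbers e1, e2, e3, e4, e5, e6 and all real numbers g_{21}, g_{22}, g_{23}, g_{31}, g_{32}, g_{33} (representing the components e_{2,K} and e_{3,K} of the strain gradients), the free energy density Ψ = B1 e1² + B2 (e2² + e3²) + B3 e3 (e3² - 3 e2²) + B4 (e2² + e3²)² + B5 (e4² + e5² + e6²) + l² (g_{21}² + g_{22}² + g_{23}² + g_{31}² + g_{32}² + g_{33}²) satisfies Ψ ≥ -1, with equality possible only when e1 = e4 = e5 = e6 = 0 (if B1, B5 > 0), all gradient components vanish (if l > 0), and (e2, e3) is one of the three well points (0, -r), ((√3/2) r, r/2), (-(√3/2)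 r, r/2). -/
/-- The three-well density, rescaled to wells on the unit circle, plus its depth, splits into a
radial and an angular part, both nonnegative. -/
lemma three_well_decomposition (x y : ℝ) :
    ∃ s : ℝ, 0 ≤ s ∧ s ^ 2 = x ^ 2 + y ^ 2 ∧ 0 ≤ s ^ 3 + y * (y ^ 2 - 3 * x ^ 2) ∧
      -3 / 2 * (x ^ 2 + y ^ 2) + y * (y ^ 2 - 3 * x ^ 2) + 3 / 2 * (x ^ 2 + y ^ 2) ^ 2 + 1
        = (s - 1) ^ 2 * (3 / 2 * s ^ 2 + 2 * s + 1) + (s ^ 3 + y * (y ^ 2 - 3 * x ^ 2)) := by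
  have hs : √(x ^ 2 + y ^ 2) ^ 2 = x ^ 2 + y ^ 2 := Real.sq_sqrt (by positivity)
  have hs0 := Real.sqrt_nonneg (x ^ 2 + y ^ 2)
  generalize √(x ^ 2 + y ^ 2) = s at hs hs0
  refine ⟨s, hs0, hs, ?_, ?_⟩
  · have h3 : (s ^ 3) ^ 2 = (x ^ 2 + y ^ 2) ^ 3 := by rw [← hs]; ring
    have h := abs_le_of_sq_le_sq' (a := y * (y ^ 2 - 3 * x ^ 2)) (b := s ^ 3)
      (by rw [h3]; nlinarith [sq_nonneg (x * (3 * y ^ 2 - x ^ 2))]) (by positivity)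
    linarith [h.1]
  · rw [← hs]; ring

lemma three_well_nonneg (x y : ℝ) :
    0 ≤ -3 / 2 * (x ^ 2 + y ^ 2) + y * (y ^ 2 - 3 * x ^ 2)
      + 3 / 2 * (x ^ 2 + y ^ 2) ^ 2 + 1 := by
  obtain ⟨s, hs, -, hc, h⟩ := three_well_decomposition x y
  rw [h]
  positivity

lemma three_well_eq_zero {x y : ℝ}
    (h0 : -3 / 2 * (x ^ 2 + y ^ 2) + y * (y ^ 2 - 3 * x ^ 2)
      + 3 / 2 * (x ^ 2 + y ^ 2) ^ 2 + 1 = 0) :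
    (x = 0 ∧ y = -1) ∨ (x = √3 / 2 ∧ y = 1 / 2) ∨ (x = -(√3 / 2) ∧ y = 1 / 2) := by
  obtain ⟨s, hs, hsq, hc, h⟩ := three_well_decomposition x y
  have hq : 0 < 3 / 2 * s ^ 2 + 2 * s + 1 := by positivity
  have hr : 0 ≤ (s - 1) ^ 2 * (3 / 2 * s ^ 2 + 2 * s + 1) := by positivity
  have hr0 : (s - 1) ^ 2 * (3 / 2 * s ^ 2 + 2 * s + 1) = 0 := by linarith
  have hs1 : s = 1 := by
    have := pow_eq_zero_iff two_ne_zero |>.1 ((mul_eq_zero.1 hr0).resolve_right hq.ne')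
    linarith
  subst hs1
  have hx : x ^ 2 = 1 - y ^ 2 := by linarith
  have hy : (y + 1) * (2 * y - 1) ^ 2 = 0 := by
    rw [hx] at h hc h0
    linarith
  rcases mul_eq_zero.1 hy with hy | hy
  · have hy1 : y = -1 := by linarith
    subst hy1
    exact Or.inl ⟨pow_eq_zero_iff two_ne_zero |>.1 (by linarith), rfl⟩
  · have hy1 : y = 1 / 2 := by linarith [pow_eq_zero_iff two_ne_zero |>.1 hy]
    subst hy1
    have h3 : x ^ 2 = (√3 / 2) ^ 2 := by
      rw [div_pow, Real.sq_sqrt (by norm_num)]; linarith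
    rcases sq_eq_sq_iff_eq_or_eq_neg.1 h3 with h | h
    · exact Or.inr (Or.inl ⟨h, rfl⟩)
    · exact Or.inr (Or.inr ⟨h, rfl⟩)


/-- Fix `r > 0`, `B1 ≥ 0`, `B5 ≥ 0`, `l ≥ 0`, and set `B2 = -3/(2 r²)`, `B3 = 1/r³`,
`B4 = 3/(2 r⁴)`.  Then for all real strain measures `e1, …, e6` and all real strain
gradient components `g21, …, g33`, the free energy density
`Ψ = B1 e1² + B2 (e2² + e3²) + B3 e3 (e3² - 3 e2²) + B4 (e2² + e3²)²
  + B5 (e4² + e5² + e6²) + l² (g21² + g22² + g23² + g31² + g32² + g33²)`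
satisfies `Ψ ≥ -1`, with equality possible only when `e1 = e4 = e5 = e6 = 0`
(if `B1, B5 > 0`), all gradient components vanish (if `l > 0`), and `(e2, e3)` is one
of the three well points `(0, -r)`, `((√3/2) r, r/2)`, `(-(√3/2) r, r/2)`. -/
theorem free_energy_density_lower_bound (r B1 B5 l : ℝ) (hr : 0 < r)
    (hB1 : 0 ≤ B1) (hB5 : 0 ≤ B5) (hl : 0 ≤ l)
    (e1 e2 e3 e4 e5 e6 g21 g22 g23 g31 g32 g33 : ℝ) :
    B1 * e1 ^ 2 + (-3 / (2 * r ^ 2)) * (e2 ^ 2 + e3 ^ 2)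
        + (1 / r ^ 3) * (e3 * (e3 ^ 2 - 3 * e2 ^ 2))
        + (3 / (2 * r ^ 4)) * (e2 ^ 2 + e3 ^ 2) ^ 2
        + B5 * (e4 ^ 2 + e5 ^ 2 + e6 ^ 2)
        + l ^ 2 * (g21 ^ 2 + g22 ^ 2 + g23 ^ 2 + g31 ^ 2 + g32 ^ 2 + g33 ^ 2) ≥ -1 ∧
    (B1 * e1 ^ 2 + (-3 / (2 * r ^ 2)) * (e2 ^ 2 + e3 ^ 2)
        + (1 / r ^ 3) * (e3 * (e3 ^ 2 - 3 * e2 ^ 2))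
        + (3 / (2 * r ^ 4)) * (e2 ^ 2 + e3 ^ 2) ^ 2
        + B5 * (e4 ^ 2 + e5 ^ 2 + e6 ^ 2)
        + l ^ 2 * (g21 ^ 2 + g22 ^ 2 + g23 ^ 2 + g31 ^ 2 + g32 ^ 2 + g33 ^ 2) = -1 →
      (0 < B1 ∧ 0 < B5 → e1 = 0 ∧ e4 = 0 ∧ e5 = 0 ∧ e6 = 0) ∧
      (0 < l → g21 = 0 ∧ g22 = 0 ∧ g23 = 0 ∧ g31 = 0 ∧ g32 = 0 ∧ g33 = 0) ∧
      ((e2, e3) = ((0 : ℝ), -r) ∨ (e2, e3) = (Real.sqrt 3 / 2 * r, r / 2) ∨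
        (e2, e3) = (-(Real.sqrt 3 / 2 * r), r / 2))) := by
  have hscale : (-3 / (2 * r ^ 2)) * (e2 ^ 2 + e3 ^ 2)
        + (1 / r ^ 3) * (e3 * (e3 ^ 2 - 3 * e2 ^ 2))
        + (3 / (2 * r ^ 4)) * (e2 ^ 2 + e3 ^ 2) ^ 2
      = -3 / 2 * ((e2 / r) ^ 2 + (e3 / r) ^ 2) + e3 / r * ((e3 / r) ^ 2 - 3 * (e2 / r) ^ 2)
        + 3 / 2 * ((e2 / r) ^ 2 + (e3 / r) ^ 2) ^ 2 := by
    field_simp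
  have hW := three_well_nonneg (e2 / r) (e3 / r)
  have h1 : 0 ≤ B1 * e1 ^ 2 := by positivity
  have h5 : 0 ≤ B5 * (e4 ^ 2 + e5 ^ 2 + e6 ^ 2) := by positivity
  have hg : 0 ≤ l ^ 2 * (g21 ^ 2 + g22 ^ 2 + g23 ^ 2 + g31 ^ 2 + g32 ^ 2 + g33 ^ 2) := by
    positivity
  refine ⟨by linarith, fun h => ⟨fun ⟨hB1, hB5⟩ => ?_, fun hl => ?_, ?_⟩⟩
  · have h1' : B1 * e1 ^ 2 = 0 := by linarith
    have h5' : B5 * (e4 ^ 2 + e5 ^ 2 + e6 ^ 2) = 0 := by linarith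
    have h1'' := (mul_eq_zero.1 h1').resolve_left hB1.ne'
    have h5'' := (mul_eq_zero.1 h5').resolve_left hB5.ne'
    refine ⟨?_, ?_, ?_, ?_⟩ <;> refine pow_eq_zero_iff two_ne_zero |>.1 ?_ <;>
      linarith [sq_nonneg e4, sq_nonneg e5, sq_nonneg e6]
  · have hg' : l ^ 2 * (g21 ^ 2 + g22 ^ 2 + g23 ^ 2 + g31 ^ 2 + g32 ^ 2 + g33 ^ 2) = 0 := by
      linarith
    have hg'' := (mul_eq_zero.1 hg').resolve_left (by positivity)
    refine ⟨?_, ?_, ?_, ?_, ?_, ?_⟩ <;> refine pow_eq_zero_iff two_ne_zero |>.1 ?_ <;>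
      linarith [sq_nonneg g21, sq_nonneg g22, sq_nonneg g23, sq_nonneg g31, sq_nonneg g32,
        sq_nonneg g33]
  · have h0 := three_well_eq_zero (x := e2 / r) (y := e3 / r) (by linarith)
    simp only [div_eq_iff hr.ne'] at h0
    simp only [Prod.mk.injEq]
    rcases h0 with ⟨hx, hy⟩ | ⟨hx, hy⟩ | ⟨hx, hy⟩
    · exact Or.inl ⟨by linarith, by linarith⟩
    · exact Or.inr (Or.inl ⟨hx, by linarith⟩)
    · exact Or.inr (Or.inr ⟨by linarith, by linarith⟩)
end
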